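/- The standard monomials in the minors p(A,B) with |A| = |B| ≤ n (including the empty monomial 1) form a basis of the ring of invariants K[X]^{GL_n(K)} as a K-vector space. -/

import Mathlib

namespace SMB

/-- `geTup f g` : the strictly increasing tuple `f` is `≥` the strictly increasing tuple `g`
in the order on increasing tuples: the length of `f` is at most that of `g`, and `f` is
entrywise `≥` `g` (on the common range of indices). -/
def geTup {N s s' : ℕ} (f : Fin s → Fin N) (g : Fin s' → Fin N) : Prop :=
  ∃ h : s ≤ s', ∀ j : Fin s, g (Fin.castLE h j) ≤ f j

/-- A strictly increasing `s`-tuple with values in `{1,…,N}` (encoded as `Fin N`). -/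
structure IncTup (s N : ℕ) where
  f : Fin s → Fin N
  mono : StrictMono f

/-- A pair of strictly increasing tuples of a common length `s`: row indices in `{1,…,m}`
and column indices in `{1,…,q}`, indexing an `s × s` minor. -/
structure PairIx (m q : ℕ) where
  s : ℕ
  rows : Fin s → Fin m
  cols : Fin s → Fin q
  rmono : StrictMono rows
  cmono : StrictMono cols

/-- The partial order `(A,B) ⪰ (A',B')` on pairs of increasing tuples: `A ≥ A'` and `B ≥ B'`. -/
def PairIx.ge {m q : ℕ} (x y : PairIx m q) : Prop :=
  geTup x.rows y.rows ∧ geTup x.cols y.cols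

end SMB
namespace SMB

variable (K : Type) [Field K] (n m q : ℕ)

/-- The coordinate ring `K[X]` of `X = M_{m,n}(K) × M_{n,q}(K)`: the polynomial ring over `K`
in the entries of a generic `m×n` matrix `U` and a generic `n×q` matrix `W`. -/
abbrev KX := MvPolynomial ((Fin m × Fin n) ⊕ (Fin n × Fin q)) K

/-- The generic `m×n` matrix `U = (u_{ij})`. -/
noncomputable def Ugen : Matrix (Fin m) (Fin n) (KX K n m q) :=
  Matrix.of fun i j => MvPolynomial.X (Sum.inl (i, j))

/-- The generic `n×q` matrix `W = (ξ_{kl})`. -/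
noncomputable def Wgen : Matrix (Fin n) (Fin q) (KX K n m q) :=
  Matrix.of fun k l => MvPolynomial.X (Sum.inr (k, l))

/-- `φ_{ij}`, the `(i,j)` entry of the product matrix `UW`. -/
noncomputable def phi (i : Fin m) (j : Fin q) : KX K n m q :=
  (Ugen K n m q * Wgen K n m q) i j

/-- Evaluation of a polynomial in `K[X]` at a point `(U, W) ∈ X`. -/
noncomputable def evalX (U : Matrix (Fin m) (Fin n) K) (W : Matrix (Fin n) (Fin q) K) :
    KX K n m q →+* K :=
  MvPolynomial.eval (Sum.elim (fun p => U p.1 p.2) (fun p => W p.1 p.2))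

variable {K n m q}

/-- `f ∈ K[X]` is invariant under the diagonal action of `GL_n(K)`:
`f(UA, A⁻¹W) = f(U, W)` for all `A ∈ GL_n(K)` and all `(U,W) ∈ X`. -/
def IsGLInvariant (f : KX K n m q) : Prop :=
  ∀ (A : GL (Fin n) K) (U : Matrix (Fin m) (Fin n) K) (W : Matrix (Fin n) (Fin q) K),
    evalX K n m q (U * (A : Matrix (Fin n) (Fin n) K))
      (((A⁻¹ : GL (Fin n) K) : Matrix (Fin n) (Fin n) K) * W) f = evalX K n m q U W f

/-- `f ∈ K[X]` is invariant under the diagonal action of `SL_n(K)`: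
`f(UA, A⁻¹W) = f(U, W)` for all `A ∈ SL_n(K)` and all `(U,W) ∈ X`. -/
def IsSLInvariant (f : KX K n m q) : Prop :=
  ∀ (A : Matrix.SpecialLinearGroup (Fin n) K)
    (U : Matrix (Fin m) (Fin n) K) (W : Matrix (Fin n) (Fin q) K),
    evalX K n m q (U * (A : Matrix (Fin n) (Fin n) K))
      (((A⁻¹ : Matrix.SpecialLinearGroup (Fin n) K) : Matrix (Fin n) (Fin n) K) * W) f
      = evalX K n m q U W f

variable (K n m q)

end SMB
namespace SMB

variable (K : Type) [Field K] (n m q : ℕ)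

/-- The ring of invariants `K[X]^{GL_n(K)}`, as a subalgebra of `K[X]`. -/
noncomputable def glInvariants : Subalgebra K (KX K n m q) where
  carrier := {f | IsGLInvariant f}
  mul_mem' := by
    intro a b ha hb A U W
    rw [map_mul, map_mul, ha A U W, hb A U W]
  one_mem' := by intro A U W; rw [map_one, map_one]
  add_mem' := by
    intro a b ha hb A U W
    rw [map_add, map_add, ha A U W, hb A U W]
  zero_mem' := by intro A U W; rw [map_zero, map_zero]
  algebraMap_mem' := by
    intro c A U W
    simp only [MvPolynomial.algebraMap_eq, evalX, MvPolynomial.eval_C]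

end SMB
namespace SMB

variable (K : Type) [Field K] (n m q : ℕ)

/-- `p(A,B)`: the minor of the product matrix `UW` with row indices `A` and column indices `B`. -/
noncomputable def pPoly (x : PairIx m q) : KX K n m q :=
  Matrix.det (Matrix.of fun i j : Fin x.s =>
    (Ugen K n m q * Wgen K n m q) (x.rows i) (x.cols j))

/-- `u(I)`: the maximal (`n×n`) minor of `U` with row indices `I`. -/
noncomputable def uPoly (I : Fin n → Fin m) : KX K n m q :=
  Matrix.det (Matrix.of fun i j : Fin n => MvPolynomial.X (Sum.inl (I i, j)))

/-- `ξ(J)`: the maximal (`n×n`) minor of `W` with column indices `J`. -/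
noncomputable def xiPoly (J : Fin n → Fin q) : KX K n m q :=
  Matrix.det (Matrix.of fun i j : Fin n => MvPolynomial.X (Sum.inr (i, J j)))

end SMB

namespace SMB

section Exchange

variable {R : Type*} [CommRing R] {ι P : Type*}

/-- An alternating map with some of its arguments frozen, as an alternating map in the others. -/
def restrictAlternating {M N : Type*} [AddCommGroup M] [Module R M] [AddCommGroup N] [Module R N]
    (f : M [⋀^ι]→ₗ[R] N) (Q : ι → Prop) [DecidablePred Q] (z : {i // ¬ Q i} → M) :
    M [⋀^{i // Q i}]→ₗ[R] N :=
  { f.toMultilinearMap.domDomRestrict Q z with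
    map_eq_zero_of_eq' := by
      intro v i j hv hij
      refine f.map_eq_zero_of_eq _ (i := i.1) (j := j.1) ?_ (fun h => hij (Subtype.ext h))
      simpa [i.2, j.2] using hv }

theorem restrictAlternating_apply {M N : Type*} [AddCommGroup M] [Module R M] [AddCommGroup N]
    [Module R N] (f : M [⋀^ι]→ₗ[R] N) (Q : ι → Prop) [DecidablePred Q] (z : {i // ¬ Q i} → M)
    (v : {i // Q i} → M) :
    restrictAlternating f Q z v = f fun i => if h : Q i then v ⟨i, h⟩ else z ⟨i, h⟩ := rfl

/-- An alternating map with more arguments than the size of a basis vanishes. -/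
theorem alternatingMap_eq_zero_of_card_lt [Fintype ι] {M N κ : Type*} [AddCommGroup M] [Module R M]
    [AddCommGroup N] [Module R N] [Fintype κ] (b : Module.Basis κ R M)
    (h : Fintype.card κ < Fintype.card ι) (f : M [⋀^ι]→ₗ[R] N) : f = 0 := by
  refine b.ext_alternating fun v hv => ?_
  exact absurd (Fintype.card_le_of_injective v hv) (not_le.mpr h)

/-- Replace the entries of `T` at the indices satisfying `Q` by those of `v`. -/
def overwrite (T : ι → P) (Q : ι → Prop) [DecidablePred Q] (v : {i // Q i} → P) : ι → P :=
  fun i => if h : Q i then v ⟨i, h⟩ else T i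

theorem sum_overwrite [Fintype ι] (T : ι → P) (Q : ι → Prop) [DecidablePred Q] (v : {i // Q i} → P)
    (g : P → ℤ) :
    ∑ i, g (overwrite T Q v i) = ∑ i, g (v i) + ∑ i : {i // ¬ Q i}, g (T i) := by
  rw [← Fintype.sum_subtype_add_sum_subtype Q]
  congr 1
  · exact Finset.sum_congr rfl fun i _ => by simp [overwrite, i.2]
  · exact Finset.sum_congr rfl fun i _ => by simp [overwrite, i.2]

theorem overwrite_self (T : ι → P) (Q : ι → Prop) [DecidablePred Q] :
    overwrite T Q (fun i => T i) = T := by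
  funext i; simp [overwrite]

theorem sum_inl_lt_sum_perm {α β : Type*} [Fintype α] [Fintype β] (σ : Equiv.Perm (α ⊕ β))
    (h : α ⊕ β → ℤ) (hl : ∀ a, h (Sum.inl a) < 0) (hr : ∀ b, 0 ≤ h (Sum.inr b))
    {a₀ : α} {b₀ : β} (hσ : σ (Sum.inl a₀) = Sum.inr b₀) :
    ∑ a, h (Sum.inl a) < ∑ a, h (σ (Sum.inl a)) := by
  set k : α ⊕ β → ℤ := fun x => min (h x) (-1) with hk
  have h1 : ∑ x, k (σ x) = ∑ x, k x := Equiv.sum_comp σ k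
  rw [Fintype.sum_sum_type, Fintype.sum_sum_type] at h1
  have h2 : ∑ a, k (Sum.inl a) = ∑ a, h (Sum.inl a) :=
    Finset.sum_congr rfl fun a _ => min_eq_left (by have := hl a; omega)
  have h3 : ∑ b : β, k (Sum.inr b) = ∑ _b : β, (-1 : ℤ) :=
    Finset.sum_congr rfl fun b _ => min_eq_right (by have := hr b; omega)
  have h4 : ∑ b : β, k (σ (Sum.inr b)) ≤ ∑ _b : β, (-1 : ℤ) :=
    Finset.sum_le_sum fun b _ => min_le_right _ _
  have h5 : ∑ a, k (σ (Sum.inl a)) < ∑ a, h (σ (Sum.inl a)) := by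
    refine Finset.sum_lt_sum (fun a _ => min_le_left _ _) ⟨a₀, Finset.mem_univ _, ?_⟩
    rw [hσ]
    have := hr b₀
    simp only [hk]
    omega
  omega

/-- Garnir-type exchange: if the sequence `T` has more entries below the threshold `θ` than `S`,
the product of determinants attached to `T` and `S` is a combination of such products in which
the total weight of the first sequence has increased. -/
theorem exchange_mem_span [Fintype ι] [DecidableEq ι] (c : P → ι → R) (ρ : P → ℤ) (θ : ℤ) (T S : ι → P)
    (hTS : Fintype.card {i // ρ (S i) < θ} < Fintype.card {i // ρ (T i) < θ}) :
    Matrix.det (Matrix.of fun i => c (T i)) * Matrix.det (Matrix.of fun i => c (S i)) ∈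
      Submodule.span ℤ {z | ∃ T' S' : ι → P, ∑ i, ρ (T i) < ∑ i, ρ (T' i) ∧
        ∑ i, ρ (T' i) + ∑ i, ρ (S' i) = ∑ i, ρ (T i) + ∑ i, ρ (S i) ∧
        z = Matrix.det (Matrix.of fun i => c (T' i)) *
          Matrix.det (Matrix.of fun i => c (S' i))} := by
  classical
  let Q₁ : ι → Prop := fun i => ρ (T i) < θ
  let Q₂ : ι → Prop := fun i => ¬ ρ (S i) < θ
  let D : (ι → R) [⋀^ι]→ₗ[R] R := Matrix.detRowAlternating
  let a := restrictAlternating D Q₁ (fun i => c (T i))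
  let b := restrictAlternating D Q₂ (fun i => c (S i))
  let v : {i // Q₁ i} ⊕ {i // Q₂ i} → P := Sum.elim (fun i => T i) (fun i => S i)
  let T' : Equiv.Perm ({i // Q₁ i} ⊕ {i // Q₂ i}) → ι → P :=
    fun σ => overwrite T Q₁ fun i => v (σ (Sum.inl i))
  let S' : Equiv.Perm ({i // Q₁ i} ⊕ {i // Q₂ i}) → ι → P :=
    fun σ => overwrite S Q₂ fun i => v (σ (Sum.inr i))
  let F : Equiv.Perm ({i // Q₁ i} ⊕ {i // Q₂ i}) → R := fun σ =>
    Matrix.det (Matrix.of fun i => c (T' σ i)) * Matrix.det (Matrix.of fun i => c (S' σ i))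
  have hcard : Fintype.card ι < Fintype.card ({i // Q₁ i} ⊕ {i // Q₂ i}) := by
    rw [Fintype.card_sum, Fintype.card_subtype_compl]
    have := Fintype.card_subtype_le fun i => ρ (S i) < θ
    have h' : Fintype.card {i // Q₁ i} = Fintype.card {i // ρ (T i) < θ} :=
      Fintype.card_congr (Equiv.refl _)
    omega
  have hzero : a.domCoprod b = 0 :=
    alternatingMap_eq_zero_of_card_lt (Pi.basisFun R ι) hcard _
  have ha : ∀ σ : Equiv.Perm ({i // Q₁ i} ⊕ {i // Q₂ i}),
      a (fun i => c (v (σ (Sum.inl i)))) = Matrix.det (Matrix.of fun i => c (T' σ i)) := by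
    intro σ
    rw [restrictAlternating_apply]
    change Matrix.det _ = _
    congr 1
    ext i j
    simp only [Matrix.of_apply, T', overwrite]
    split_ifs <;> rfl
  have hb : ∀ σ : Equiv.Perm ({i // Q₁ i} ⊕ {i // Q₂ i}),
      b (fun i => c (v (σ (Sum.inr i)))) = Matrix.det (Matrix.of fun i => c (S' σ i)) := by
    intro σ
    rw [restrictAlternating_apply]
    change Matrix.det _ = _
    congr 1
    ext i j
    simp only [Matrix.of_apply, S', overwrite]
    split_ifs <;> rfl
  have hsummand : ∀ σ : Equiv.Perm ({i // Q₁ i} ⊕ {i // Q₂ i}),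
      LinearMap.mul' R R (AlternatingMap.domCoprod.summand a b (Quotient.mk'' σ)
        fun x => c (v x)) = Equiv.Perm.sign σ • F σ := by
    intro σ
    rw [AlternatingMap.domCoprod.summand_mk'']
    have hF : LinearMap.mul' R R (((MultilinearMap.domCoprod ↑a ↑b :
        MultilinearMap R (fun _ => ι → R) (TensorProduct R R R)).domDomCongr σ)
          fun x => c (v x)) = F σ := by
      rw [MultilinearMap.domDomCongr_apply, MultilinearMap.domCoprod_apply, LinearMap.mul'_apply]
      exact congrArg₂ (· * ·) (ha σ) (hb σ)
    rw [← hF]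
    rcases Int.units_eq_one_or (Equiv.Perm.sign σ) with h | h <;> simp [h]
  have hsum : ∑ τ : Equiv.Perm.ModSumCongr {i // Q₁ i} {i // Q₂ i},
      LinearMap.mul' R R (AlternatingMap.domCoprod.summand a b τ fun x => c (v x)) = 0 := by
    rw [← map_sum, ← sum_apply]
    have := congrArg (fun f => LinearMap.mul' R R (f fun x => c (v x))) hzero
    simpa [AlternatingMap.domCoprod_apply] using this
  replace hsum := (Finset.add_sum_erase _ _ (Finset.mem_univ
    (Quotient.mk'' 1 : Equiv.Perm.ModSumCongr {i // Q₁ i} {i // Q₂ i}))).trans hsum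
  have hone : F 1 =
      Matrix.det (Matrix.of fun i => c (T i)) * Matrix.det (Matrix.of fun i => c (S i)) := by
    simp only [F, T', S', Equiv.Perm.one_apply, v, Sum.elim_inl, Sum.elim_inr]
    rw [overwrite_self, overwrite_self]
  rw [hsummand, Equiv.Perm.sign_one, one_smul, hone] at hsum
  rw [eq_neg_of_add_eq_zero_left hsum]
  refine Submodule.neg_mem _ (Submodule.sum_mem _ fun τ hτ => ?_)
  induction τ using Quotient.inductionOn' with | _ σ
  rw [hsummand, Units.smul_def]
  refine Submodule.smul_mem _ _ (Submodule.subset_span ⟨T' σ, S' σ, ?_, ?_, rfl⟩)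
  · have hne : ¬ Set.MapsTo σ (Set.range Sum.inl) (Set.range Sum.inl) := by
      intro hm
      refine (Finset.mem_erase.mp hτ).1 ?_
      refine (Quotient.sound' ?_).symm
      rw [QuotientGroup.leftRel_apply]
      simpa using Equiv.Perm.mem_sumCongrHom_range_of_perm_mapsTo_inl hm
    obtain ⟨a₀, b₀, hab⟩ : ∃ a₀ b₀, σ (Sum.inl a₀) = Sum.inr b₀ := by
      by_contra! hcon
      refine hne ?_
      rintro _ ⟨a₀, rfl⟩
      rcases hx : σ (Sum.inl a₀) with x | x
      · exact ⟨x, rfl⟩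
      · exact absurd hx (hcon a₀ x)
    have key := sum_inl_lt_sum_perm σ (fun x => ρ (v x) - θ)
      (fun x => by have := x.2; simp only [Q₁] at this; simp only [v, Sum.elim_inl]; omega)
      (fun x => by have := x.2; simp only [Q₂] at this; simp only [v, Sum.elim_inr]; omega) hab
    have h1 := sum_overwrite T Q₁ (fun i => v (σ (Sum.inl i))) ρ
    have h2 := sum_overwrite T Q₁ (fun i => T i) ρ
    rw [overwrite_self] at h2
    simp only [Finset.sum_sub_distrib, v, Sum.elim_inl] at key h1
    simp only [T', v]
    omega
  · have h1 := sum_overwrite T Q₁ (fun i => v (σ (Sum.inl i))) ρ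
    have h2 := sum_overwrite T Q₁ (fun i => T i) ρ
    have h3 := sum_overwrite S Q₂ (fun i => v (σ (Sum.inr i))) ρ
    have h4 := sum_overwrite S Q₂ (fun i => S i) ρ
    rw [overwrite_self] at h2 h4
    have h5 : ∑ x, ρ (v (σ x)) = ∑ x, ρ (v x) := Equiv.sum_comp σ fun x => ρ (v x)
    rw [Fintype.sum_sum_type, Fintype.sum_sum_type] at h5
    have h6 : ∑ i, ρ (v (Sum.inl i)) = ∑ i : {i // Q₁ i}, ρ (T i) := rfl
    have h7 : ∑ i, ρ (v (Sum.inr i)) = ∑ i : {i // Q₂ i}, ρ (S i) := rfl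
    simp only [T', S']
    omega

end Exchange

end SMB

namespace SMB

section Straightening

variable {m q : ℕ}

@[ext]
theorem PairIx.ext_of_values {x y : PairIx m q} (hs : x.s = y.s)
    (hr : ∀ j (h : j < x.s) (h' : j < y.s), x.rows ⟨j, h⟩ = y.rows ⟨j, h'⟩)
    (hc : ∀ j (h : j < x.s) (h' : j < y.s), x.cols ⟨j, h⟩ = y.cols ⟨j, h'⟩) : x = y := by
  obtain ⟨s, r, c, _, _⟩ := x
  obtain ⟨s', r', c', _, _⟩ := y
  obtain rfl : s = s' := hs
  have h1 : r = r' := funext fun j => hr j j.2 j.2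
  have h2 : c = c' := funext fun j => hc j j.2 j.2
  subst h1 h2
  rfl

theorem geTup_refl {N s : ℕ} (f : Fin s → Fin N) : geTup f f := ⟨le_rfl, fun _ => le_rfl⟩

theorem geTup_trans {N s s' s'' : ℕ} {f : Fin s → Fin N} {g : Fin s' → Fin N}
    {h : Fin s'' → Fin N} (hfg : geTup f g) (hgh : geTup g h) : geTup f h := by
  obtain ⟨h1, h2⟩ := hfg
  obtain ⟨h3, h4⟩ := hgh
  exact ⟨h1.trans h3, fun j => (h4 (Fin.castLE h1 j)).trans (h2 j)⟩

theorem PairIx.ge_refl (x : PairIx m q) : x.ge x := ⟨geTup_refl _, geTup_refl _⟩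

theorem PairIx.ge_trans {x y z : PairIx m q} (h : x.ge y) (h' : y.ge z) : x.ge z :=
  ⟨geTup_trans h.1 h'.1, geTup_trans h.2 h'.2⟩

theorem PairIx.ge_antisymm {x y : PairIx m q} (h : x.ge y) (h' : y.ge x) : x = y := by
  obtain ⟨⟨h1, h2⟩, ⟨_, h3⟩⟩ := h
  obtain ⟨⟨h1', h2'⟩, ⟨_, h3'⟩⟩ := h'
  refine PairIx.ext_of_values (le_antisymm h1 h1') (fun j hj hj' => ?_) fun j hj hj' => ?_
  · exact le_antisymm (h2' ⟨j, hj'⟩) (h2 ⟨j, hj⟩)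
  · exact le_antisymm (h3' ⟨j, hj'⟩) (h3 ⟨j, hj⟩)

/-- If `f` is not `≥ g`, then for some threshold `f` has more entries below it than `g`. -/
theorem exists_card_lt_of_not_geTup {N s s' : ℕ} {f : Fin s → Fin N} {g : Fin s' → Fin N}
    (hf : StrictMono f) (hg : StrictMono g) (h : ¬ geTup f g) :
    ∃ t ≤ N, (Finset.univ.filter fun j => (g j : ℕ) < t).card <
      (Finset.univ.filter fun j => (f j : ℕ) < t).card := by
  by_cases hs : s ≤ s'
  · obtain ⟨j, hj⟩ : ∃ j : Fin s, f j < g (Fin.castLE hs j) := by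
      by_contra! hcon
      exact h ⟨hs, hcon⟩
    refine ⟨f j + 1, (f j).2, ?_⟩
    have h1 : (Finset.univ.filter fun k => (g k : ℕ) < f j + 1).card ≤ j := by
      calc _ ≤ (Finset.Iio (Fin.castLE hs j)).card := by
            refine Finset.card_le_card fun k hk => ?_
            simp only [Finset.mem_filter, Finset.mem_univ, true_and, Finset.mem_Iio] at hk ⊢
            refine hg.lt_iff_lt.mp ?_
            rw [Fin.lt_def] at hj ⊢
            omega
        _ = j := by simp
    have h2 : (j : ℕ) + 1 ≤ (Finset.univ.filter fun k => (f k : ℕ) < f j + 1).card := by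
      calc (j : ℕ) + 1 = (Finset.Iic j).card := by simp
        _ ≤ _ := by
            refine Finset.card_le_card fun k hk => ?_
            simp only [Finset.mem_filter, Finset.mem_univ, true_and, Finset.mem_Iic] at hk ⊢
            have := hf.monotone hk
            rw [Fin.le_def] at this
            omega
    omega
  · refine ⟨N, le_rfl, ?_⟩
    simp only [Fin.is_lt, Finset.filter_true, Finset.card_univ, Fintype.card_fin]
    omega

/-- The set of columns of `[Z | 1]` attached to a pair: the columns in `cols`, together with the
unit vectors whose index is not in `rows`. -/
def PairIx.supp (x : PairIx m q) : Finset (Fin q ⊕ Fin m) :=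
  (Finset.univ.image x.cols).disjSum (Finset.univ.image x.rows)ᶜ

theorem PairIx.card_supp (x : PairIx m q) : x.supp.card = m := by
  rw [PairIx.supp, Finset.card_disjSum, Finset.card_compl,
    Finset.card_image_of_injective _ x.rmono.injective,
    Finset.card_image_of_injective _ x.cmono.injective, Finset.card_univ, Fintype.card_fin,
    Fintype.card_fin]
  have := Fintype.card_le_of_injective _ x.rmono.injective
  simp only [Fintype.card_fin] at this
  omega

/-- The position of a column of `[Z | 1]` in the order where the unit vectors come last, in
reverse order. -/
def colRank : Fin q ⊕ Fin m → ℤ :=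
  Sum.elim (fun b => (b : ℤ)) (fun c => (q : ℤ) + m - 1 - c)

/-- The total rank of the columns attached to a pair. -/
def PairIx.weight (x : PairIx m q) : ℤ := ∑ p ∈ x.supp, colRank p

theorem PairIx.weight_nonneg (x : PairIx m q) : 0 ≤ x.weight := by
  refine Finset.sum_nonneg fun p _ => ?_
  rcases p with b | c
  · simp [colRank]
  · have := c.2
    simp only [colRank, Sum.elim_inr]
    omega

theorem PairIx.weight_le (x : PairIx m q) : x.weight ≤ m * (q + m) := by
  have : ∀ p ∈ x.supp, colRank p ≤ (q + m : ℤ) := by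
    intro p _
    rcases p with b | c
    · have := b.2
      simp only [colRank, Sum.elim_inl]
      omega
    · simp only [colRank, Sum.elim_inr]
      omega
  have h := Finset.sum_le_card_nsmul _ _ _ this
  rwa [x.card_supp, nsmul_eq_mul] at h

theorem exists_threshold_of_not_ge {x y : PairIx m q} (h : ¬ x.ge y) :
    ∃ θ : ℤ, (y.supp.filter fun p => colRank p < θ).card <
      (x.supp.filter fun p => colRank p < θ).card := by
  have hcount : ∀ (z : PairIx m q) (θ : ℤ), (z.supp.filter fun p => colRank p < θ).card =
      (Finset.univ.filter fun j => ((z.cols j : ℕ) : ℤ) < θ).card +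
      ((Finset.univ.image z.rows)ᶜ.filter fun c : Fin m => (q : ℤ) + m - 1 - c < θ).card := by
    intro z θ
    rw [Finset.card_filter, Finset.card_filter, Finset.card_filter, PairIx.supp,
      Finset.sum_disjSum, Finset.sum_image fun a _ b _ hab => z.cmono.injective hab]
    rfl
  by_cases hc : geTup x.cols y.cols
  · have hr : ¬ geTup x.rows y.rows := fun hr => h ⟨hr, hc⟩
    obtain ⟨t, htm, ht⟩ := exists_card_lt_of_not_geTup x.rmono y.rmono hr
    refine ⟨(q : ℤ) + m - t, ?_⟩
    have hrow : ∀ z : PairIx m q,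
        (z.supp.filter fun p => colRank p < (q : ℤ) + m - t).card =
          (Finset.univ.filter fun j => (z.rows j : ℕ) < t).card +
            (Finset.univ.filter fun c : Fin m => ¬ (c : ℕ) < t).card := by
      intro z
      rw [hcount]
      have h1 : (Finset.univ.filter fun j => ((z.cols j : ℕ) : ℤ) < (q : ℤ) + m - t).card
          = z.s := by
        rw [Finset.filter_true_of_mem, Finset.card_univ, Fintype.card_fin]
        intro j _
        have := (z.cols j).2
        omega
      have h2 : (Finset.univ.filter fun c : Fin m => ¬ (c : ℕ) < t).card =
          ((Finset.univ.image z.rows)ᶜ.filter fun c : Fin m => ¬ (c : ℕ) < t).card +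
          ((Finset.univ.image z.rows).filter fun c : Fin m => ¬ (c : ℕ) < t).card := by
        simp only [Finset.card_filter]
        rw [add_comm, Finset.sum_add_sum_compl]
      have h3 : ((Finset.univ.image z.rows).filter fun c : Fin m => ¬ (c : ℕ) < t).card =
          (Finset.univ.filter fun j => ¬ (z.rows j : ℕ) < t).card := by
        simp only [Finset.card_filter]
        rw [Finset.sum_image fun a _ b _ hab => z.rmono.injective hab]
      have h4 := Finset.card_filter_add_card_filter_not (s := (Finset.univ : Finset (Fin z.s)))
        (fun j => (z.rows j : ℕ) < t)
      rw [Finset.card_univ, Fintype.card_fin] at h4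
      have h5 : ((Finset.univ.image z.rows)ᶜ.filter
          fun c : Fin m => (q : ℤ) + m - 1 - c < (q : ℤ) + m - t).card =
          ((Finset.univ.image z.rows)ᶜ.filter fun c : Fin m => ¬ (c : ℕ) < t).card := by
        congr 1
        refine Finset.filter_congr fun c _ => ?_
        omega
      omega
    rw [hrow, hrow]
    omega
  · obtain ⟨t, htq, ht⟩ := exists_card_lt_of_not_geTup x.cmono y.cmono hc
    refine ⟨t, ?_⟩
    have hcol : ∀ z : PairIx m q, (z.supp.filter fun p => colRank p < (t : ℤ)).card =
        (Finset.univ.filter fun j => (z.cols j : ℕ) < t).card := by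
      intro z
      rw [hcount]
      have h1 : (Finset.univ.image z.rows)ᶜ.filter
          (fun c : Fin m => (q : ℤ) + m - 1 - c < t) = ∅ := by
        refine Finset.filter_false_of_mem fun c _ => ?_
        have := c.2
        omega
      rw [h1]
      simp
    rw [hcol, hcol]
    exact ht

variable {R : Type*} [CommRing R]

/-- The minor of `Z` with the given rows and columns. -/
def minor (Z : Matrix (Fin m) (Fin q) R) (x : PairIx m q) : R :=
  Matrix.det (Matrix.of fun i j : Fin x.s => Z (x.rows i) (x.cols j))

/-- The columns of the block matrix `[Z | 1]`. -/
def blockCol (Z : Matrix (Fin m) (Fin q) R) : Fin q ⊕ Fin m → Fin m → R :=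
  Sum.elim (fun b i => Z i b) (fun c => Pi.single c 1)

theorem exists_supp_eq (F : Finset (Fin q ⊕ Fin m)) (hF : F.card = m) :
    ∃ x : PairIx m q, x.supp = F := by
  have hcard : F.toLeft.card + F.toRight.card = m := by
    rw [Finset.card_toLeft_add_card_toRight, hF]
  have hr : (F.toRightᶜ).card = F.toLeft.card := by
    rw [Finset.card_compl, Fintype.card_fin]
    omega
  refine ⟨⟨F.toLeft.card, F.toRightᶜ.orderEmbOfFin hr, F.toLeft.orderEmbOfFin rfl,
    (F.toRightᶜ.orderEmbOfFin hr).strictMono, (F.toLeft.orderEmbOfFin rfl).strictMono⟩, ?_⟩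
  simp only [PairIx.supp, Finset.image_orderEmbOfFin_univ, compl_compl]
  exact Finset.toLeft_disjSum_toRight

theorem det_submatrix_equiv_equiv {ι κ : Type*} [Fintype ι] [DecidableEq ι] [Fintype κ]
    [DecidableEq κ] (e₁ e₂ : κ ≃ ι) (M : Matrix ι ι R) :
    ∃ ε : ℤˣ, M.det = ε • (M.submatrix e₁ e₂).det := by
  refine ⟨Equiv.Perm.sign (e₁.symm.trans e₂), ?_⟩
  have h : M.submatrix e₁ e₂ = (M.submatrix id (e₁.symm.trans e₂)).submatrix e₁ e₁ := by
    ext i j; simp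
  rw [h, Matrix.det_submatrix_equiv_self, Matrix.det_permute']
  rcases Int.units_eq_one_or (Equiv.Perm.sign (e₁.symm.trans e₂)) with h | h <;> simp [h]

/-- A maximal minor of `[Z | 1]` is, up to sign, a minor of `Z`. -/
theorem det_blockCol_eq (Z : Matrix (Fin m) (Fin q) R) (T : Fin m → Fin q ⊕ Fin m)
    (x : PairIx m q) (hT : Function.Injective T) (hx : Finset.univ.image T = x.supp) :
    ∃ ε : ℤˣ, Matrix.det (Matrix.of fun i => blockCol Z (T i)) = ε • minor Z x := by
  let C := {c : Fin m // c ∉ Set.range x.rows}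
  let f : Fin x.s ⊕ C → Fin q ⊕ Fin m := Sum.map x.cols Subtype.val
  have hf : Function.Injective f := x.cmono.injective.sumMap Subtype.val_injective
  have hmem : ∀ p, p ∈ x.supp ↔ ∃ k, f k = p := by
    rintro (b | c)
    · simp [PairIx.supp, f]
    · simp [PairIx.supp, f, C]
  have hex : ∀ k, ∃ i, T i = f k := by
    intro k
    have : f k ∈ Finset.univ.image T := by rw [hx, hmem]; exact ⟨k, rfl⟩
    simpa using this
  choose g hg using hex
  have hgb : Function.Bijective g := by
    refine ⟨fun a b hab => hf (by rw [← hg, ← hg, hab]), fun i => ?_⟩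
    have : T i ∈ x.supp := by rw [← hx]; simp
    obtain ⟨k, hk⟩ := (hmem _).mp this
    exact ⟨k, hT (by rw [hg, hk])⟩
  let r : Fin x.s ⊕ C → Fin m := Sum.elim x.rows Subtype.val
  have hr : Function.Bijective r := by
    constructor
    · refine x.rmono.injective.sumElim Subtype.val_injective fun a b hab => b.2 ⟨a, hab⟩
    · intro c
      by_cases hc : c ∈ Set.range x.rows
      · obtain ⟨k, rfl⟩ := hc
        exact ⟨Sum.inl k, rfl⟩
      · exact ⟨Sum.inr ⟨c, hc⟩, rfl⟩
  classical
  obtain ⟨ε, hε⟩ := det_submatrix_equiv_equiv (Equiv.ofBijective g hgb) (Equiv.ofBijective r hr)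
    (Matrix.of fun i => blockCol Z (T i))
  refine ⟨ε, hε.trans ?_⟩
  congr 1
  have hblock : (Matrix.of fun i => blockCol Z (T i)).submatrix (Equiv.ofBijective g hgb)
      (Equiv.ofBijective r hr) = Matrix.fromBlocks
        (Matrix.of fun i j : Fin x.s => Z (x.rows i) (x.cols j)).transpose
        (Matrix.of fun (k : Fin x.s) (c : C) => Z c (x.cols k)) 0 1 := by
    ext i j
    rcases i with k | c <;> rcases j with k' | c' <;>
      simp [hg, f, r, blockCol, Matrix.one_apply, Pi.single_apply]
    · exact fun h => absurd ⟨_, h⟩ c.2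
    · exact if_congr (Subtype.ext_iff.symm.trans eq_comm) rfl rfl
  rw [hblock, Matrix.det_fromBlocks_zero₂₁, Matrix.det_one, mul_one, Matrix.det_transpose]
  rfl

theorem minor_mul_minor_mem_span (Z : Matrix (Fin m) (Fin q) R) {x y : PairIx m q}
    (h : ¬ x.ge y) :
    minor Z x * minor Z y ∈ Submodule.span ℤ {z | ∃ x' y' : PairIx m q, x.weight < x'.weight ∧
      x'.weight + y'.weight = x.weight + y.weight ∧ z = minor Z x' * minor Z y'} := by
  have hparam : ∀ z : PairIx m q, ∃ T : Fin m → Fin q ⊕ Fin m, Function.Injective T ∧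
      Finset.univ.image T = z.supp := by
    intro z
    let e := z.supp.equivFinOfCardEq z.card_supp
    refine ⟨fun i => e.symm i, Subtype.val_injective.comp e.symm.injective, ?_⟩
    ext p
    simp only [Finset.mem_image, Finset.mem_univ, true_and]
    exact ⟨by rintro ⟨i, rfl⟩; exact (e.symm i).2, fun hp => ⟨e ⟨p, hp⟩, by simp⟩⟩
  have hcard : ∀ (z : PairIx m q) (T : Fin m → Fin q ⊕ Fin m), Function.Injective T →
      Finset.univ.image T = z.supp → ∀ θ : ℤ, Fintype.card {i // colRank (T i) < θ} =
        (z.supp.filter fun p => colRank p < θ).card := by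
    intro z T hT hz θ
    rw [Fintype.card_subtype, ← hz, Finset.card_filter, Finset.card_filter,
      Finset.sum_image fun a _ b _ hab => hT hab]
  have hweight : ∀ (z : PairIx m q) (T : Fin m → Fin q ⊕ Fin m), Function.Injective T →
      Finset.univ.image T = z.supp → ∑ i, colRank (T i) = z.weight := by
    intro z T hT hz
    rw [PairIx.weight, ← hz, Finset.sum_image fun a _ b _ hab => hT hab]
  obtain ⟨T, hT, hTx⟩ := hparam x
  obtain ⟨S, hS, hSy⟩ := hparam y
  obtain ⟨θ, hθ⟩ := exists_threshold_of_not_ge h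
  have hex := exchange_mem_span (blockCol Z) colRank θ T S (by
    rwa [hcard y S hS hSy, hcard x T hT hTx])
  obtain ⟨ε₁, h₁⟩ := det_blockCol_eq Z T x hT hTx
  obtain ⟨ε₂, h₂⟩ := det_blockCol_eq Z S y hS hSy
  rw [h₁, h₂, hweight x T hT hTx, hweight y S hS hSy] at hex
  have hsm : minor Z x * minor Z y =
      (ε₁ * ε₂ : ℤˣ) • (ε₁ • minor Z x * ε₂ • minor Z y) := by
    rw [smul_mul_smul_comm, smul_smul, Int.units_mul_self, one_smul]
  rw [hsm, Units.smul_def]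
  refine Submodule.smul_mem _ _ (Submodule.span_le.mpr ?_ hex)
  rintro _ ⟨T', S', hlt, hsum, rfl⟩
  by_cases hT' : Function.Injective T'
  swap
  · have : Matrix.det (Matrix.of fun i => blockCol Z (T' i)) = 0 := by
      simp only [Function.Injective, not_forall] at hT'
      obtain ⟨i, j, hij, hne⟩ := hT'
      exact Matrix.det_zero_of_row_eq hne (by funext k; simp [hij])
    rw [this, zero_mul]
    exact Submodule.zero_mem _
  by_cases hS' : Function.Injective S'
  swap
  · have : Matrix.det (Matrix.of fun i => blockCol Z (S' i)) = 0 := by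
      simp only [Function.Injective, not_forall] at hS'
      obtain ⟨i, j, hij, hne⟩ := hS'
      exact Matrix.det_zero_of_row_eq hne (by funext k; simp [hij])
    rw [this, mul_zero]
    exact Submodule.zero_mem _
  obtain ⟨x', hx'⟩ := exists_supp_eq (Finset.univ.image T') (by
    rw [Finset.card_image_of_injective _ hT', Finset.card_univ, Fintype.card_fin])
  obtain ⟨y', hy'⟩ := exists_supp_eq (Finset.univ.image S') (by
    rw [Finset.card_image_of_injective _ hS', Finset.card_univ, Fintype.card_fin])
  obtain ⟨δ₁, hd₁⟩ := det_blockCol_eq Z T' x' hT' hx'.symm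
  obtain ⟨δ₂, hd₂⟩ := det_blockCol_eq Z S' y' hS' hy'.symm
  rw [hd₁, hd₂, smul_mul_smul_comm, Units.smul_def]
  refine Submodule.smul_mem _ _ (Submodule.subset_span ⟨x', y', ?_, ?_, rfl⟩)
  · rw [← hweight x' T' hT' hx'.symm]
    exact hlt
  · rw [← hweight x' T' hT' hx'.symm, ← hweight y' S' hS' hy'.symm]
    exact hsum

end Straightening

end SMB

namespace SMB

section Lists

variable {m q : ℕ}

theorem exists_pairwise_ge_insert (x : PairIx m q) (L : List (PairIx m q))
    (hL : L.Pairwise PairIx.ge) (hx : ∀ y ∈ L, x.ge y ∨ y.ge x) :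
    ∃ L' : List (PairIx m q), L'.Perm (x :: L) ∧ L'.Pairwise PairIx.ge := by
  induction L with
  | nil => exact ⟨[x], List.Perm.refl _, List.pairwise_singleton _ _⟩
  | cons y t ih =>
    rw [List.pairwise_cons] at hL
    by_cases h : x.ge y
    · refine ⟨x :: y :: t, List.Perm.refl _, ?_⟩
      refine List.pairwise_cons.mpr ⟨fun z hz => ?_, List.pairwise_cons.mpr hL⟩
      rcases List.mem_cons.mp hz with rfl | hz
      · exact h
      · exact PairIx.ge_trans h (hL.1 z hz)
    · have hyx : y.ge x := (hx y List.mem_cons_self).resolve_left h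
      obtain ⟨t', hp, ht'⟩ := ih hL.2 fun z hz => hx z (List.mem_cons_of_mem _ hz)
      refine ⟨y :: t', (hp.cons y).trans (List.Perm.swap x y t), ?_⟩
      refine List.pairwise_cons.mpr ⟨fun z hz => ?_, ht'⟩
      rcases List.mem_cons.mp (hp.mem_iff.mp hz) with rfl | hz
      · exact hyx
      · exact hL.1 z hz

theorem exists_pairwise_ge_perm (L : List (PairIx m q))
    (h : ∀ x ∈ L, ∀ y ∈ L, x.ge y ∨ y.ge x) :
    ∃ L' : List (PairIx m q), L'.Perm L ∧ L'.Pairwise PairIx.ge := by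
  induction L with
  | nil => exact ⟨[], List.Perm.refl _, List.Pairwise.nil⟩
  | cons x t ih =>
    obtain ⟨t', hp, ht'⟩ := ih fun a ha b hb =>
      h a (List.mem_cons_of_mem _ ha) b (List.mem_cons_of_mem _ hb)
    obtain ⟨L', hL', hsorted⟩ := exists_pairwise_ge_insert x t' ht' fun y hy =>
      h x List.mem_cons_self y (List.mem_cons_of_mem _ (hp.mem_iff.mp hy))
    exact ⟨L', hL'.trans (hp.cons x), hsorted⟩

/-- The sum of the squared weights of a list of pairs. -/
def energy (L : List (PairIx m q)) : ℤ := (L.map fun x => x.weight ^ 2).sum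

theorem energy_le (L : List (PairIx m q)) : energy L ≤ L.length * ((m * (q + m) : ℤ)) ^ 2 := by
  have h := List.sum_le_card_nsmul (L.map fun x => x.weight ^ 2) (((m * (q + m) : ℤ)) ^ 2) (by
    intro z hz
    obtain ⟨x, _, rfl⟩ := List.mem_map.mp hz
    exact pow_le_pow_left₀ x.weight_nonneg x.weight_le 2)
  simpa [energy] using h

variable {R : Type*} [CommRing R]

/-- Straightening: every product of minors is a combination of standard ones. -/
theorem prod_minor_mem_span (Z : Matrix (Fin m) (Fin q) R) (L : List (PairIx m q)) :
    (L.map (minor Z)).prod ∈ Submodule.span ℤ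
      {z | ∃ L' : List (PairIx m q), L'.Pairwise PairIx.ge ∧ z = (L'.map (minor Z)).prod} := by
  classical
  induction hN : (L.length * ((m * (q + m) : ℤ)) ^ 2 - energy L).toNat using
    Nat.strong_induction_on generalizing L with
  | _ N ih =>
  subst hN
  have step : ∀ (x y : PairIx m q) (L₀ : List (PairIx m q)), L.Perm (x :: y :: L₀) →
      y.weight ≤ x.weight → ¬ x.ge y → (L.map (minor Z)).prod ∈ Submodule.span ℤ
      {z | ∃ L' : List (PairIx m q), L'.Pairwise PairIx.ge ∧
        z = (L'.map (minor Z)).prod} := by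
    intro x y L₀ hp hw hxy
    rw [(hp.map (minor Z)).prod_eq, List.map_cons, List.map_cons, List.prod_cons, List.prod_cons,
      ← mul_assoc]
    have hmem := Submodule.mem_map_of_mem (f := LinearMap.mulRight ℤ (L₀.map (minor Z)).prod)
      (minor_mul_minor_mem_span Z hxy)
    rw [Submodule.map_span] at hmem
    refine Submodule.span_le.mpr ?_ hmem
    rintro _ ⟨_, ⟨x', y', hlt, hsum, rfl⟩, rfl⟩
    have hmul : LinearMap.mulRight ℤ (L₀.map (minor Z)).prod (minor Z x' * minor Z y') =
        ((x' :: y' :: L₀).map (minor Z)).prod := by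
      simp [mul_assoc]
    rw [hmul]
    refine ih _ ?_ (x' :: y' :: L₀) rfl
    have hlen : (L.length : ℤ) = (x' :: y' :: L₀).length := by rw [hp.length_eq]; rfl
    have hen : energy L = energy (x :: y :: L₀) := (hp.map _).sum_eq
    have hlt' : energy L < energy (x' :: y' :: L₀) := by
      rw [hen]
      simp only [energy, List.map_cons, List.sum_cons]
      obtain ⟨δ, hδ⟩ : ∃ δ, x'.weight = x.weight + δ := ⟨_, (add_sub_cancel _ _).symm⟩
      have hy' : y'.weight = y.weight - δ := by linarith
      have hδ0 : 0 < δ := by linarith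
      rw [hδ, hy']
      nlinarith [mul_nonneg hδ0.le (sub_nonneg.mpr hw), mul_pos hδ0 hδ0]
    have hle := energy_le (x' :: y' :: L₀)
    rw [← hlen] at hle ⊢
    omega
  by_cases h : ∀ x ∈ L, ∀ y ∈ L, x.ge y ∨ y.ge x
  · obtain ⟨L', hp, hL'⟩ := exists_pairwise_ge_perm L h
    exact Submodule.subset_span ⟨L', hL', ((hp.map (minor Z)).prod_eq).symm⟩
  · push Not at h
    obtain ⟨x, hx, y, hy, hxy, hyx⟩ := h
    have hne : y ≠ x := by rintro rfl; exact hxy y.ge_refl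
    have hp : L.Perm (x :: y :: (L.erase x).erase y) :=
      (List.perm_cons_erase hx).trans
        ((List.perm_cons_erase ((List.mem_erase_of_ne hne).mpr hy)).cons x)
    rcases le_total y.weight x.weight with hw | hw
    · exact step x y _ hp hw hxy
    · exact step y x _ (hp.trans (List.Perm.swap y x _)) hw hyx

end Lists

section ProductExpansion

variable {R : Type*} [CommRing R] {s n : ℕ}

/-- The determinant of a product of rectangular matrices, expanded along the rows of the left
factor. -/
theorem det_mul_eq_sum (A : Matrix (Fin s) (Fin n) R) (B : Matrix (Fin n) (Fin s) R) :
    (A * B).det = ∑ g : Fin s → Fin n, (∏ i, A i (g i)) * (B.submatrix g id).det := by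
  have h : (A * B : Matrix _ _ R) = fun i => ∑ k, A i k • B k := by
    ext i j
    simp [Matrix.mul_apply, Finset.sum_apply]
  change Matrix.detRowAlternating (A * B) = _
  rw [h, ← AlternatingMap.coe_multilinearMap,
    MultilinearMap.map_sum]
  refine Finset.sum_congr rfl fun g _ => ?_
  rw [MultilinearMap.map_smul_univ]
  rfl

theorem det_submatrix_eq_zero_of_not_injective (B : Matrix (Fin n) (Fin s) R)
    {g : Fin s → Fin n} (hg : ¬ Function.Injective g) : (B.submatrix g id).det = 0 := by
  simp only [Function.Injective, not_forall] at hg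
  obtain ⟨i, j, hij, hne⟩ := hg
  exact Matrix.det_zero_of_row_eq hne (by funext k; simp [hij])

theorem det_mul_eq_zero_of_lt (A : Matrix (Fin s) (Fin n) R) (B : Matrix (Fin n) (Fin s) R)
    (h : n < s) : (A * B).det = 0 := by
  rw [det_mul_eq_sum]
  refine Finset.sum_eq_zero fun g _ => ?_
  rw [det_submatrix_eq_zero_of_not_injective, mul_zero]
  intro hg
  have := Fintype.card_le_of_injective g hg
  simp only [Fintype.card_fin] at this
  omega

end ProductExpansion

end SMB

namespace SMB

section LeadingTerm

open scoped MonomialOrder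

variable {n m q : ℕ}

/-- The key by which variables are compared: the entries of `U` column by column come first, then
the entries of `W` row by row. -/
def varKey : (Fin m × Fin n) ⊕ (Fin n × Fin q) → (Fin n ×ₗ Fin m) ⊕ₗ (Fin n ×ₗ Fin q)
  | Sum.inl p => Sum.inlₗ (toLex (p.2, p.1))
  | Sum.inr p => Sum.inrₗ (toLex p)

theorem varKey_injective : Function.Injective (varKey (n := n) (m := m) (q := q)) := by
  rintro (⟨i, j⟩ | ⟨k, l⟩) (⟨i', j'⟩ | ⟨k', l'⟩) h
  all_goals simp_all [varKey, Sum.inlₗ, Sum.inrₗ]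

variable (n m q) in
/-- The lexicographic monomial order in which the variables with small key are significant. -/
noncomputable def columnOrder : MonomialOrder ((Fin m × Fin n) ⊕ (Fin n × Fin q)) :=
  letI := LinearOrder.lift' (varKey (n := n) (m := m) (q := q)) varKey_injective
  @MonomialOrder.lex _ this (@Finite.to_wellFoundedGT _ _ this.toPartialOrder.toPreorder)

theorem columnOrder_lt {a b : ((Fin m × Fin n) ⊕ (Fin n × Fin q)) →₀ ℕ}
    (v : (Fin m × Fin n) ⊕ (Fin n × Fin q)) (h : ∀ u, varKey u < varKey v → a u = b u)
    (hv : a v < b v) : a ≺[columnOrder n m q] b :=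
  letI := LinearOrder.lift' (varKey (n := n) (m := m) (q := q)) varKey_injective
  (@MonomialOrder.lex_lt_iff _ this
    (@Finite.to_wellFoundedGT _ _ this.toPartialOrder.toPreorder) a b).mpr ⟨v, h, hv⟩

/-- The exponent of the monomial `∏ i, u_{a i, g i} * ∏ i, ξ_{h i, b i}`. -/
noncomputable def pathExp {s : ℕ} (a : Fin s → Fin m) (g h : Fin s → Fin n) (b : Fin s → Fin q) :
    ((Fin m × Fin n) ⊕ (Fin n × Fin q)) →₀ ℕ :=
  (∑ i, Finsupp.single (Sum.inl (a i, g i)) 1) + ∑ i, Finsupp.single (Sum.inr (h i, b i)) 1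

theorem pathExp_inl {s : ℕ} (a : Fin s → Fin m) (g h : Fin s → Fin n) (b : Fin s → Fin q)
    (i : Fin m) (j : Fin n) :
    pathExp a g h b (Sum.inl (i, j)) = (Finset.univ.filter fun k => a k = i ∧ g k = j).card := by
  simp [pathExp, Finsupp.single_apply]

theorem pathExp_inr {s : ℕ} (a : Fin s → Fin m) (g h : Fin s → Fin n) (b : Fin s → Fin q)
    (k : Fin n) (l : Fin q) :
    pathExp a g h b (Sum.inr (k, l)) = (Finset.univ.filter fun i => b i = l ∧ h i = k).card := by
  simp [pathExp, Finsupp.single_apply, and_comm]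

theorem exists_first_difference {s N : ℕ} {a : Fin s → Fin N} (ha : StrictMono a) (hs : s ≤ n)
    {g : Fin s → Fin n} (hg : Function.Injective g) (hne : g ≠ Fin.castLE hs) :
    ∃ i₀ : Fin s, (∀ r c, toLex (c, r) < toLex (Fin.castLE hs i₀, a i₀) →
        (Finset.univ.filter fun k => a k = r ∧ g k = c).card =
          (Finset.univ.filter fun k => a k = r ∧ Fin.castLE hs k = c).card) ∧
      (Finset.univ.filter fun k => a k = a i₀ ∧ g k = Fin.castLE hs i₀).card <
        (Finset.univ.filter fun k => a k = a i₀ ∧ Fin.castLE hs k = Fin.castLE hs i₀).card := by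
  have hex : (Finset.univ.filter fun i => g i ≠ Fin.castLE hs i).Nonempty := by
    by_contra hcon
    rw [Finset.not_nonempty_iff_eq_empty, Finset.filter_eq_empty_iff] at hcon
    exact hne (funext fun i => not_not.mp (hcon (Finset.mem_univ i)))
  set i₀ := Finset.min' _ hex with hi₀
  have h0 : g i₀ ≠ Fin.castLE hs i₀ := (Finset.mem_filter.mp (Finset.min'_mem _ hex)).2
  have hlt : ∀ i < i₀, g i = Fin.castLE hs i := by
    intro i hi
    by_contra hcon
    exact absurd (Finset.min'_le _ i (Finset.mem_filter.mpr ⟨Finset.mem_univ _, hcon⟩))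
      (not_le.mpr hi)
  clear_value i₀
  refine ⟨i₀, fun r c hrc => ?_, ?_⟩
  · congr 1
    refine Finset.filter_congr fun k _ => and_congr_right fun hk => ?_
    rcases Prod.Lex.toLex_lt_toLex.mp hrc with hc | ⟨hc, hr⟩
    · simp only at hc
      have hcs : (c : ℕ) < s := by rw [Fin.lt_def] at hc; exact hc.trans i₀.2
      obtain ⟨c', rfl⟩ : ∃ c' : Fin s, Fin.castLE hs c' = c := ⟨⟨c, hcs⟩, rfl⟩
      rw [← hlt c' hc, hg.eq_iff, hlt c' hc, (Fin.castLE_injective hs).eq_iff]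
    · simp only at hc hr
      subst hc
      rw [(Fin.castLE_injective hs).eq_iff, ← hk, ha.lt_iff_lt] at *
      refine ⟨fun h => absurd ((hlt k hr).symm.trans h) ?_, fun h => absurd h hr.ne⟩
      rw [(Fin.castLE_injective hs).eq_iff]
      exact hr.ne
  · rw [Finset.card_eq_zero.mpr, Finset.card_pos]
    · exact ⟨i₀, by simp⟩
    · rw [Finset.filter_eq_empty_iff]
      rintro k - ⟨hk, hk'⟩
      rw [ha.injective hk] at hk'
      exact h0 hk'

theorem pathExp_lt {s : ℕ} {a : Fin s → Fin m} {b : Fin s → Fin q} (ha : StrictMono a)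
    (hb : StrictMono b) (hs : s ≤ n) {g h : Fin s → Fin n} (hg : Function.Injective g)
    (hh : Function.Injective h) (hne : ¬ (g = Fin.castLE hs ∧ h = Fin.castLE hs)) :
    pathExp a g h b ≺[columnOrder n m q] pathExp a (Fin.castLE hs) (Fin.castLE hs) b := by
  by_cases hgi : g = Fin.castLE hs
  · obtain ⟨i₀, h1, h2⟩ := exists_first_difference hb hs hh fun hhi => hne ⟨hgi, hhi⟩
    refine columnOrder_lt (Sum.inr (Fin.castLE hs i₀, b i₀)) ?_ ?_
    · rintro (⟨i, j⟩ | ⟨k, l⟩) hu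
      · rw [pathExp_inl, pathExp_inl, hgi]
      · rw [pathExp_inr, pathExp_inr]
        exact h1 l k (Sum.Lex.inr_lt_inr_iff.mp hu)
    · rw [pathExp_inr, pathExp_inr]
      exact h2
  · obtain ⟨i₀, h1, h2⟩ := exists_first_difference ha hs hg hgi
    refine columnOrder_lt (Sum.inl (a i₀, Fin.castLE hs i₀)) ?_ ?_
    · rintro (⟨i, j⟩ | ⟨k, l⟩) hu
      · rw [pathExp_inl, pathExp_inl]
        exact h1 i j (Sum.Lex.inl_lt_inl_iff.mp hu)
      · exact absurd hu Sum.Lex.not_inr_lt_inl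
    · rw [pathExp_inl, pathExp_inl]
      exact h2

variable (K : Type) [Field K]

/-- The exponent of the leading monomial of a minor of `UW`. -/
noncomputable def PairIx.lead (x : PairIx m q) (hx : x.s ≤ n) :
    ((Fin m × Fin n) ⊕ (Fin n × Fin q)) →₀ ℕ :=
  pathExp x.rows (Fin.castLE hx) (Fin.castLE hx) x.cols

theorem pPoly_eq_det_mul (x : PairIx m q) :
    pPoly K n m q x =
      ((Ugen K n m q).submatrix x.rows id * (Wgen K n m q).submatrix id x.cols).det := rfl

theorem pPoly_eq_sum (x : PairIx m q) :
    pPoly K n m q x = ∑ g : Fin x.s → Fin n, ∑ τ : Equiv.Perm (Fin x.s),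
      if Function.Injective g then
        MvPolynomial.monomial (pathExp x.rows g (g ∘ τ) x.cols) ((Equiv.Perm.sign τ : ℤ) : K)
      else 0 := by
  rw [pPoly_eq_det_mul, det_mul_eq_sum]
  refine Finset.sum_congr rfl fun g _ => ?_
  by_cases hg : Function.Injective g
  · simp only [hg, if_true]
    rw [Matrix.det_apply', Finset.mul_sum]
    refine Finset.sum_congr rfl fun τ _ => ?_
    have h1 : ∀ (ι : Fin x.s → (Fin m × Fin n) ⊕ (Fin n × Fin q)),
        ∏ i, (MvPolynomial.X (ι i) : KX K n m q) =
          MvPolynomial.monomial (∑ i, Finsupp.single (ι i) 1) 1 := by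
      intro ι
      rw [MvPolynomial.monomial_sum_one]
      rfl
    simp only [Ugen, Wgen, Matrix.submatrix_apply, Matrix.of_apply, id]
    rw [h1, h1, mul_left_comm, MvPolynomial.monomial_mul, one_mul, pathExp,
      ← map_intCast (MvPolynomial.C : K →+* KX K n m q), MvPolynomial.C_mul_monomial, mul_one]
    rfl
  · simp only [hg, if_false, Finset.sum_const_zero]
    exact mul_eq_zero_of_right _ (det_submatrix_eq_zero_of_not_injective
      ((Wgen K n m q).submatrix id x.cols) hg)

theorem coeff_pPoly (x : PairIx m q) (hx : x.s ≤ n)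
    (d : ((Fin m × Fin n) ⊕ (Fin n × Fin q)) →₀ ℕ) (hd : x.lead hx ≼[columnOrder n m q] d) :
    (pPoly K n m q x).coeff d = if d = x.lead hx then 1 else 0 := by
  rw [pPoly_eq_sum, MvPolynomial.coeff_sum, Finset.sum_eq_single (Fin.castLE hx),
    MvPolynomial.coeff_sum, Finset.sum_eq_single 1, if_pos (Fin.castLE_injective hx),
    MvPolynomial.coeff_monomial]
  · have : (Fin.castLE hx ∘ (1 : Equiv.Perm (Fin x.s))) = Fin.castLE hx := rfl
    rw [this, ← PairIx.lead]
    simp only [Equiv.Perm.sign_one, Units.val_one, Int.cast_one, eq_comm]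
  · intro τ _ hτ
    rw [if_pos (Fin.castLE_injective hx), MvPolynomial.coeff_monomial, if_neg]
    rintro rfl
    refine absurd hd (not_le.mpr (pathExp_lt x.rmono x.cmono hx (Fin.castLE_injective hx)
      ((Fin.castLE_injective hx).comp τ.injective) fun h => hτ ?_))
    exact Equiv.ext fun i => Fin.castLE_injective hx (congrFun h.2 i)
  · simp
  · intro g _ hg
    rw [MvPolynomial.coeff_sum]
    refine Finset.sum_eq_zero fun τ _ => ?_
    split_ifs with hgi
    · rw [MvPolynomial.coeff_monomial, if_neg]
      rintro rfl
      exact absurd hd (not_le.mpr (pathExp_lt x.rmono x.cmono hx hgi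
        (hgi.comp τ.injective) fun h => hg h.1))
    · simp
  · simp

theorem coeff_lead_pPoly (x : PairIx m q) (hx : x.s ≤ n) :
    (pPoly K n m q x).coeff (x.lead hx) = 1 := by
  rw [coeff_pPoly K x hx _ le_rfl, if_pos rfl]

theorem pPoly_ne_zero (x : PairIx m q) (hx : x.s ≤ n) : pPoly K n m q x ≠ 0 := by
  intro h
  have := coeff_lead_pPoly K x hx
  rw [h] at this
  simp at this

theorem degree_pPoly (x : PairIx m q) (hx : x.s ≤ n) :
    (columnOrder n m q).degree (pPoly K n m q x) = x.lead hx := by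
  refine (columnOrder n m q).toSyn.injective (le_antisymm ?_ ?_)
  · rw [MonomialOrder.degree_le_iff]
    intro d hd
    by_contra hlt
    rw [not_le] at hlt
    rw [MvPolynomial.mem_support_iff, coeff_pPoly K x hx d hlt.le, if_neg] at hd
    · exact hd rfl
    · rintro rfl
      exact hlt.false
  · refine MonomialOrder.le_degree ?_
    rw [MvPolynomial.mem_support_iff, coeff_lead_pPoly]
    exact one_ne_zero

end LeadingTerm

end SMB

namespace SMB

section Decoding

variable {n m q : ℕ}

/-- The sum of the leading exponents of a list of pairs. -/
noncomputable def listLead (L : List {x : PairIx m q // 0 < x.s ∧ x.s ≤ n}) :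
    ((Fin m × Fin n) ⊕ (Fin n × Fin q)) →₀ ℕ :=
  (L.map fun x => x.val.lead x.2.2).sum

theorem PairIx.lead_inl_pos {x : PairIx m q} {hx : x.s ≤ n} {i : Fin m} {j : Fin n} :
    0 < x.lead hx (Sum.inl (i, j)) ↔ ∃ k, x.rows k = i ∧ Fin.castLE hx k = j := by
  rw [PairIx.lead, pathExp_inl, Finset.card_pos]
  simp [Finset.Nonempty]

theorem PairIx.lead_inr_pos {x : PairIx m q} {hx : x.s ≤ n} {k : Fin n} {l : Fin q} :
    0 < x.lead hx (Sum.inr (k, l)) ↔ ∃ i, x.cols i = l ∧ Fin.castLE hx i = k := by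
  rw [PairIx.lead, pathExp_inr, Finset.card_pos]
  simp [Finset.Nonempty]

theorem exists_mem_lead_pos {L : List {x : PairIx m q // 0 < x.s ∧ x.s ≤ n}}
    {v : (Fin m × Fin n) ⊕ (Fin n × Fin q)} (h : 0 < listLead L v) :
    ∃ z ∈ L, 0 < z.val.lead z.2.2 v := by
  induction L with
  | nil => simp [listLead] at h
  | cons a t ih =>
    rw [listLead, List.map_cons, List.sum_cons, Finsupp.add_apply] at h
    rcases Nat.eq_zero_or_pos (a.val.lead a.2.2 v) with h0 | h0
    · rw [h0, zero_add] at h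
      obtain ⟨z, hz, hz'⟩ := ih h
      exact ⟨z, List.mem_cons_of_mem _ hz, hz'⟩
    · exact ⟨a, List.mem_cons_self, h0⟩

theorem geTup_of_pointwise {N s s' : ℕ} {f : Fin s → Fin N} {g : Fin s' → Fin N} (hs : 0 < s)
    (h : ∀ j : Fin s, ∃ hj : (j : ℕ) < s', g ⟨j, hj⟩ ≤ f j) : geTup f g := by
  refine ⟨?_, fun j => (h j).2⟩
  obtain ⟨hj, _⟩ := h ⟨s - 1, by omega⟩
  simp only at hj
  omega

/-- A pair whose leading exponent divides that of a list dominates every lower bound of the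
list. -/
theorem PairIx.ge_of_lead_le {L : List {x : PairIx m q // 0 < x.s ∧ x.s ≤ n}} {x y : PairIx m q}
    (hy : ∀ z ∈ L, z.val.ge y) (hx0 : 0 < x.s) (hx : x.s ≤ n) (h : x.lead hx ≤ listLead L) :
    x.ge y := by
  constructor
  · refine geTup_of_pointwise hx0 fun j => ?_
    obtain ⟨z, hz, hz'⟩ := exists_mem_lead_pos (lt_of_lt_of_le
      (PairIx.lead_inl_pos.mpr ⟨j, rfl, rfl⟩) (h (Sum.inl (x.rows j, Fin.castLE hx j))))
    obtain ⟨k, hk, hkj⟩ := PairIx.lead_inl_pos.mp hz'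
    obtain ⟨hle, hzy⟩ := (hy z hz).1
    have hkj' : (k : ℕ) = j := by simpa using congrArg Fin.val hkj
    have hjs : (j : ℕ) < y.s := by have := k.2; omega
    refine ⟨hjs, ?_⟩
    rw [← hk, show (⟨j, hjs⟩ : Fin y.s) = Fin.castLE hle k from Fin.ext hkj'.symm]
    exact hzy k
  · refine geTup_of_pointwise hx0 fun j => ?_
    obtain ⟨z, hz, hz'⟩ := exists_mem_lead_pos (lt_of_lt_of_le
      (PairIx.lead_inr_pos.mpr ⟨j, rfl, rfl⟩) (h (Sum.inr (Fin.castLE hx j, x.cols j))))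
    obtain ⟨k, hk, hkj⟩ := PairIx.lead_inr_pos.mp hz'
    obtain ⟨hle, hzy⟩ := (hy z hz).2
    have hkj' : (k : ℕ) = j := by simpa using congrArg Fin.val hkj
    have hjs : (j : ℕ) < y.s := by have := k.2; omega
    refine ⟨hjs, ?_⟩
    rw [← hk, show (⟨j, hjs⟩ : Fin y.s) = Fin.castLE hle k from Fin.ext hkj'.symm]
    exact hzy k

theorem PairIx.lead_ne_zero {x : PairIx m q} (hx0 : 0 < x.s) (hx : x.s ≤ n) : x.lead hx ≠ 0 := by
  intro h
  have := (PairIx.lead_inl_pos (hx := hx)).mpr ⟨⟨0, hx0⟩, rfl, rfl⟩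
  rw [h] at this
  exact this.false

theorem listLead_append (L L' : List {x : PairIx m q // 0 < x.s ∧ x.s ≤ n}) :
    listLead (L ++ L') = listLead L + listLead L' := by
  simp [listLead]

theorem listLead_singleton (x : {x : PairIx m q // 0 < x.s ∧ x.s ≤ n}) :
    listLead [x] = x.val.lead x.2.2 := by
  simp [listLead]

theorem ge_last_of_pairwise {L : List {x : PairIx m q // 0 < x.s ∧ x.s ≤ n}}
    {y : {x : PairIx m q // 0 < x.s ∧ x.s ≤ n}}
    (h : (L ++ [y]).Pairwise fun a b => a.val.ge b.val) : ∀ z ∈ L ++ [y], z.val.ge y.val := by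
  intro z hz
  rcases List.mem_append.mp hz with hz | hz
  · exact (List.pairwise_append.mp h).2.2 z hz y (List.mem_singleton_self y)
  · rw [List.mem_singleton.mp hz]
    exact PairIx.ge_refl _

theorem lead_le_listLead_append (L : List {x : PairIx m q // 0 < x.s ∧ x.s ≤ n})
    (y : {x : PairIx m q // 0 < x.s ∧ x.s ≤ n}) :
    y.val.lead y.2.2 ≤ listLead (L ++ [y]) := by
  rw [listLead_append, listLead_singleton]
  exact le_add_self

theorem listLead_append_ne_zero (L : List {x : PairIx m q // 0 < x.s ∧ x.s ≤ n})
    (y : {x : PairIx m q // 0 < x.s ∧ x.s ≤ n}) : listLead (L ++ [y]) ≠ 0 := by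
  intro h
  have := lead_le_listLead_append L y
  rw [h] at this
  exact PairIx.lead_ne_zero y.2.1 y.2.2 (le_bot_iff.mp this)

/-- A standard list is determined by its leading exponent. -/
theorem eq_of_listLead_eq {L L' : List {x : PairIx m q // 0 < x.s ∧ x.s ≤ n}}
    (hL : L.Pairwise fun a b => a.val.ge b.val) (hL' : L'.Pairwise fun a b => a.val.ge b.val)
    (h : listLead L = listLead L') : L = L' := by
  induction L using List.reverseRecOn generalizing L' with
  | nil =>
    rcases List.eq_nil_or_concat' L' with rfl | ⟨t, y, rfl⟩
    · rfl
    · exact absurd h.symm (listLead_append_ne_zero t y)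
  | append_singleton L x ih =>
    rcases List.eq_nil_or_concat' L' with rfl | ⟨t, y, rfl⟩
    · exact absurd h (listLead_append_ne_zero L x)
    · have hxy : x = y := by
        refine Subtype.ext (PairIx.ge_antisymm ?_ ?_)
        · exact PairIx.ge_of_lead_le (ge_last_of_pairwise hL') x.2.1 x.2.2
            (h ▸ lead_le_listLead_append L x)
        · exact PairIx.ge_of_lead_le (ge_last_of_pairwise hL) y.2.1 y.2.2
            (h ▸ lead_le_listLead_append t y)
      subst hxy
      rw [listLead_append, listLead_append, add_left_inj] at h
      rw [ih (List.pairwise_append.mp hL).1 (List.pairwise_append.mp hL').1 h]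

theorem castLE_le_of_strictMono {s N n : ℕ} {f : Fin s → Fin N} (hf : StrictMono f) (hs : s ≤ n)
    (hn : n ≤ N) (j : Fin s) : Fin.castLE hn (Fin.castLE hs j) ≤ f j := by
  have h := Finset.card_le_card_of_injOn f (s := Finset.Iio j) (t := Finset.Iio (f j))
    (fun i hi => by simpa using hf (by simpa using hi)) hf.injective.injOn
  simpa [Fin.le_def] using h

/-- The pair indexing the top left maximal minor. -/
def PairIx.initial (hm : n ≤ m) (hq : n ≤ q) : PairIx m q where
  s := n
  rows := Fin.castLE hm
  cols := Fin.castLE hq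
  rmono := Fin.strictMono_castLE hm
  cmono := Fin.strictMono_castLE hq

theorem PairIx.ge_initial (hm : n ≤ m) (hq : n ≤ q) {x : PairIx m q} (hx : x.s ≤ n) :
    x.ge (PairIx.initial hm hq) :=
  ⟨⟨hx, castLE_le_of_strictMono x.rmono hx hm⟩, ⟨hx, castLE_le_of_strictMono x.cmono hx hq⟩⟩

theorem exists_append_initial (hn : 0 < n) (hm : n ≤ m) (hq : n ≤ q)
    {L : List {x : PairIx m q // 0 < x.s ∧ x.s ≤ n}}
    (hL : L.Pairwise fun a b => a.val.ge b.val)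
    (h : (PairIx.initial hm hq).lead le_rfl ≤ listLead L) :
    ∃ L', L = L' ++ [⟨PairIx.initial hm hq, hn, le_rfl⟩] := by
  rcases List.eq_nil_or_concat' L with rfl | ⟨t, y, rfl⟩
  · exact absurd (le_bot_iff.mp h) (PairIx.lead_ne_zero hn le_rfl)
  · have hy : y = ⟨PairIx.initial hm hq, hn, le_rfl⟩ := by
      refine Subtype.ext (PairIx.ge_antisymm (PairIx.ge_initial hm hq y.2.2) ?_)
      exact PairIx.ge_of_lead_le (ge_last_of_pairwise hL) hn le_rfl h
    exact ⟨t, by rw [hy]⟩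

variable (K : Type) [Field K]

theorem prod_pPoly_ne_zero (L : List {x : PairIx m q // 0 < x.s ∧ x.s ≤ n}) :
    (L.map fun x => pPoly K n m q x.val).prod ≠ 0 := by
  refine List.prod_ne_zero fun h => ?_
  obtain ⟨x, _, hx⟩ := List.mem_map.mp h
  exact pPoly_ne_zero K x.val x.2.2 hx

theorem degree_prod_pPoly (L : List {x : PairIx m q // 0 < x.s ∧ x.s ≤ n}) :
    (columnOrder n m q).degree (L.map fun x => pPoly K n m q x.val).prod = listLead L := by
  induction L with
  | nil => simp [listLead]
  | cons a t ih =>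
    rw [List.map_cons, List.prod_cons, MonomialOrder.degree_mul (pPoly_ne_zero K a.val a.2.2)
      (prod_pPoly_ne_zero K t), ih, degree_pPoly K a.val a.2.2]
    simp [listLead]

end Decoding

section DistinctDegrees

open scoped MonomialOrder

variable {σ ι K : Type*} [Field K] (M : MonomialOrder σ) {v : ι → MvPolynomial σ K}

theorem exists_degree_linearCombination_eq (hv : ∀ i, v i ≠ 0)
    (hinj : Function.Injective fun i => M.degree (v i)) {l : ι →₀ K} (hl : l ≠ 0) :
    Finsupp.linearCombination K v l ≠ 0 ∧
      ∃ i ∈ l.support, M.degree (Finsupp.linearCombination K v l) = M.degree (v i) := by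
  obtain ⟨i, hi, hmax⟩ := Finset.exists_max_image l.support (fun i => M.toSyn (M.degree (v i)))
    (Finsupp.support_nonempty_iff.mpr hl)
  have hcoeff : (Finsupp.linearCombination K v l).coeff (M.degree (v i)) ≠ 0 := by
    rw [Finsupp.linearCombination_apply, Finsupp.sum, MvPolynomial.coeff_sum,
      Finset.sum_eq_single i]
    · rw [MvPolynomial.coeff_smul, smul_eq_mul]
      exact mul_ne_zero (Finsupp.mem_support_iff.mp hi)
        (MonomialOrder.coeff_degree_ne_zero_iff.mpr (hv i))
    · intro j hj hji
      rw [MvPolynomial.coeff_smul, MonomialOrder.coeff_eq_zero_of_lt, smul_zero]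
      exact lt_of_le_of_ne (hmax j hj) fun h => hji (hinj (M.toSyn.injective h))
    · exact fun h => absurd hi h
  refine ⟨fun h => hcoeff (by rw [h, MvPolynomial.coeff_zero]), i, hi,
    M.toSyn.injective (le_antisymm ?_ ?_)⟩
  · rw [MonomialOrder.degree_le_iff]
    intro d hd
    by_contra hlt
    rw [not_le] at hlt
    refine MvPolynomial.mem_support_iff.mp hd ?_
    rw [Finsupp.linearCombination_apply, Finsupp.sum, MvPolynomial.coeff_sum]
    refine Finset.sum_eq_zero fun j hj => ?_
    rw [MvPolynomial.coeff_smul, MonomialOrder.coeff_eq_zero_of_lt, smul_zero]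
    exact (hmax j hj).trans_lt hlt
  · exact MonomialOrder.le_degree (MvPolynomial.mem_support_iff.mpr hcoeff)

theorem linearIndependent_of_degree_injective (hv : ∀ i, v i ≠ 0)
    (hinj : Function.Injective fun i => M.degree (v i)) : LinearIndependent K v := by
  rw [linearIndependent_iff]
  intro l hl
  by_contra hne
  exact (exists_degree_linearCombination_eq M hv hinj hne).1 hl

/-- If every member of a family with distinct degrees whose degree is divisible by that of `d` is
`d` times a member of the family, then the span of the family is closed under division by `d`. -/
theorem mem_span_of_mul_mem_span (hv : ∀ i, v i ≠ 0)
    (hinj : Function.Injective fun i => M.degree (v i)) {d : MvPolynomial σ K} (hd : d ≠ 0)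
    (hdiv : ∀ i, M.degree d ≤ M.degree (v i) → ∃ j, v i = d * v j) {f : MvPolynomial σ K}
    (hf : d * f ∈ Submodule.span K (Set.range v)) : f ∈ Submodule.span K (Set.range v) := by
  classical
  obtain ⟨l, hl⟩ := (Finsupp.mem_span_range_iff_exists_finsupp).mp hf
  change Finsupp.linearCombination K v l = d * f at hl
  clear hf
  induction hN : l.support.card using Nat.strong_induction_on generalizing l f with
  | _ N ih =>
  subst hN
  by_cases h0 : l = 0
  · rw [h0, map_zero] at hl
    rw [(mul_eq_zero.mp hl.symm).resolve_left hd]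
    exact zero_mem _
  obtain ⟨hne, i, hi, hdeg⟩ := exists_degree_linearCombination_eq M hv hinj h0
  rw [hl] at hne hdeg
  rw [MonomialOrder.degree_mul hd (right_ne_zero_of_mul hne)] at hdeg
  obtain ⟨j, hj⟩ := hdiv i (hdeg ▸ le_self_add)
  have hmem : f - l i • v j ∈ Submodule.span K (Set.range v) := by
    refine ih _ (?_ : (l.erase i).support.card < _) (l.erase i) ?_ rfl
    · rw [Finsupp.support_erase]
      exact Finset.card_erase_lt_of_mem hi
    · rw [Finsupp.erase_eq_sub_single, map_sub, hl, Finsupp.linearCombination_single, mul_sub,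
        mul_smul_comm, ← hj]
  rw [← sub_add_cancel f (l i • v j)]
  exact add_mem hmem (Submodule.smul_mem _ _ (Submodule.subset_span ⟨j, rfl⟩))

end DistinctDegrees

end SMB

namespace SMB

section Spanning

variable (K : Type) [Field K] (n m q : ℕ)

/-- The linear span of the standard monomials. -/
noncomputable def standardSpan : Submodule K (KX K n m q) :=
  Submodule.span K {z | ∃ L : List {x : PairIx m q // 0 < x.s ∧ x.s ≤ n},
    L.Pairwise (fun a b => a.val.ge b.val) ∧ z = (L.map fun x => pPoly K n m q x.val).prod}

variable {n m q}

theorem pPoly_eq_zero_of_lt {x : PairIx m q} (h : n < x.s) : pPoly K n m q x = 0 := by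
  rw [pPoly_eq_det_mul]
  exact det_mul_eq_zero_of_lt _ _ h

theorem pPoly_eq_one_of_eq_zero {x : PairIx m q} (h : x.s = 0) : pPoly K n m q x = 1 := by
  have : IsEmpty (Fin x.s) := by rw [h]; infer_instance
  exact Matrix.det_isEmpty

theorem exists_standard_prod_eq (L : List (PairIx m q)) (hL : L.Pairwise PairIx.ge)
    (hs : ∀ x ∈ L, x.s ≤ n) : ∃ L' : List {x : PairIx m q // 0 < x.s ∧ x.s ≤ n},
      L'.Pairwise (fun a b => a.val.ge b.val) ∧ (∀ x ∈ L', x.val ∈ L) ∧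
      (L.map (pPoly K n m q)).prod = (L'.map fun x => pPoly K n m q x.val).prod := by
  induction L with
  | nil => exact ⟨[], List.Pairwise.nil, by simp, rfl⟩
  | cons a t ih =>
    rw [List.pairwise_cons] at hL
    obtain ⟨L', h1, h2, h3⟩ := ih hL.2 fun x hx => hs x (List.mem_cons_of_mem _ hx)
    rcases Nat.eq_zero_or_pos a.s with h0 | h0
    · refine ⟨L', h1, fun x hx => List.mem_cons_of_mem _ (h2 x hx), ?_⟩
      rw [List.map_cons, List.prod_cons, pPoly_eq_one_of_eq_zero K h0, one_mul, h3]
    · refine ⟨⟨a, h0, hs a List.mem_cons_self⟩ :: L', ?_, ?_, ?_⟩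
      · exact List.pairwise_cons.mpr ⟨fun x hx => hL.1 _ (h2 x hx), h1⟩
      · intro x hx
        rcases List.mem_cons.mp hx with rfl | hx
        · exact List.mem_cons_self
        · exact List.mem_cons_of_mem _ (h2 x hx)
      · rw [List.map_cons, List.map_cons, List.prod_cons, List.prod_cons, h3]

theorem prod_pPoly_mem_standardSpan (L : List (PairIx m q)) :
    (L.map (pPoly K n m q)).prod ∈ standardSpan K n m q := by
  have h := prod_minor_mem_span (Ugen K n m q * Wgen K n m q) L
  refine (Submodule.span_le (p := (standardSpan K n m q).restrictScalars ℤ)).mpr ?_ h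
  rintro _ ⟨L', hL', rfl⟩
  change (L'.map (pPoly K n m q)).prod ∈ standardSpan K n m q
  by_cases hs : ∀ x ∈ L', x.s ≤ n
  · obtain ⟨L'', h1, -, h2⟩ := exists_standard_prod_eq K L' hL' hs
    exact Submodule.subset_span ⟨L'', h1, h2⟩
  · push Not at hs
    obtain ⟨x, hx, hxs⟩ := hs
    rw [List.prod_eq_zero (List.mem_map.mpr ⟨x, hx, pPoly_eq_zero_of_lt K hxs⟩)]
    exact zero_mem _

theorem standardSpan_mul_le :
    standardSpan K n m q * standardSpan K n m q ≤ standardSpan K n m q := by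
  conv_lhs => rw [standardSpan, Submodule.span_mul_span]
  refine Submodule.span_le.mpr ?_
  rintro _ ⟨_, ⟨L, -, rfl⟩, _, ⟨L', -, rfl⟩, rfl⟩
  have h := prod_pPoly_mem_standardSpan K (n := n) ((L ++ L').map Subtype.val)
  simpa [List.map_map, Function.comp_def] using h

variable (n m q) in
/-- The linear span of the standard monomials, as a subalgebra. -/
noncomputable def standardSubalgebra : Subalgebra K (KX K n m q) :=
  (standardSpan K n m q).toSubalgebra (prod_pPoly_mem_standardSpan K [])
    fun _ _ hx hy => standardSpan_mul_le K (Submodule.mul_mem_mul hx hy)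

theorem pPoly_mem_standardSubalgebra (x : PairIx m q) :
    pPoly K n m q x ∈ standardSubalgebra K n m q := by
  have h := prod_pPoly_mem_standardSpan K (n := n) [x]
  rwa [List.map_singleton, List.prod_singleton] at h

theorem phi_mem_standardSubalgebra (i : Fin m) (j : Fin q) :
    phi K n m q i j ∈ standardSubalgebra K n m q := by
  have h := pPoly_mem_standardSubalgebra K (n := n) (m := m) (q := q)
    ⟨1, fun _ => i, fun _ => j, Subsingleton.strictMono _, Subsingleton.strictMono _⟩
  rw [pPoly, Matrix.det_unique] at h
  exact h

theorem det_mem_of_forall_mem {R : Type*} [CommRing R] {ι : Type*} [Fintype ι] [DecidableEq ι]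
    {T : Type*} [SetLike T R] [SubringClass T R] {S : T} {A : Matrix ι ι R}
    (h : ∀ i j, A i j ∈ S) : A.det ∈ S := by
  rw [Matrix.det_apply']
  exact sum_mem fun τ _ => mul_mem (intCast_mem _ _) (prod_mem fun i _ => h _ _)

theorem adjugate_mem_of_forall_mem {R : Type*} [CommRing R] {ι : Type*} [Fintype ι]
    [DecidableEq ι] {T : Type*} [SetLike T R] [SubringClass T R] {S : T} {A : Matrix ι ι R}
    (h : ∀ i j, A i j ∈ S) (i j : ι) : A.adjugate i j ∈ S := by
  rw [Matrix.adjugate_apply]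
  refine det_mem_of_forall_mem fun k l => ?_
  rw [Matrix.updateRow_apply, Pi.single_apply]
  split_ifs
  · exact one_mem _
  · exact zero_mem _
  · exact h k l

/-- Clearing denominators after substituting the fractions `P v / d` for the variables. -/
theorem exists_clear_denominators {σ k : Type*} [Field k] (S : Subalgebra k (MvPolynomial σ k))
    {d : MvPolynomial σ k} (hd : d ∈ S) {P : σ → MvPolynomial σ k} (hP : ∀ v, P v ∈ S)
    (f : MvPolynomial σ k) : ∃ N : ℕ, ∃ G ∈ S, ∀ pt : σ → k, MvPolynomial.eval pt d ≠ 0 →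
      MvPolynomial.eval pt G = MvPolynomial.eval pt d ^ N *
        MvPolynomial.eval (fun v => MvPolynomial.eval pt (P v) / MvPolynomial.eval pt d) f := by
  induction f using MvPolynomial.induction_on with
  | C a => exact ⟨0, MvPolynomial.C a, S.algebraMap_mem a, fun pt _ => by simp⟩
  | add f g hf hg =>
    obtain ⟨N, G, hG, h⟩ := hf
    obtain ⟨N', G', hG', h'⟩ := hg
    refine ⟨N + N', d ^ N' * G + d ^ N * G',
      add_mem (mul_mem (pow_mem hd _) hG) (mul_mem (pow_mem hd _) hG'), fun pt hpt => ?_⟩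
    simp only [map_add, map_mul, map_pow, h pt hpt, h' pt hpt]
    ring
  | mul_X f v hf =>
    obtain ⟨N, G, hG, h⟩ := hf
    refine ⟨N + 1, G * P v, mul_mem hG (hP v), fun pt hpt => ?_⟩
    simp only [map_mul, MvPolynomial.eval_X, h pt hpt]
    field_simp
    ring

variable {K}

theorem evalX_phi (U : Matrix (Fin m) (Fin n) K) (W : Matrix (Fin n) (Fin q) K) (i : Fin m)
    (j : Fin q) : evalX K n m q U W (phi K n m q i j) = (U * W) i j := by
  simp [evalX, phi, Ugen, Wgen, Matrix.mul_apply]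

theorem evalX_pPoly (U : Matrix (Fin m) (Fin n) K) (W : Matrix (Fin n) (Fin q) K)
    (x : PairIx m q) :
    evalX K n m q U W (pPoly K n m q x) = ((U * W).submatrix x.rows x.cols).det := by
  rw [pPoly, RingHom.map_det]
  congr 1
  ext i j
  exact evalX_phi U W _ _

theorem pPoly_mem_glInvariants (x : PairIx m q) : pPoly K n m q x ∈ glInvariants K n m q := by
  intro A U W
  rw [evalX_pPoly, evalX_pPoly, Matrix.mul_assoc, ← Matrix.mul_assoc (A : Matrix (Fin n) (Fin n) K),
    ← Units.val_mul, mul_inv_cancel, Units.val_one, Matrix.one_mul]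

/-- An invariant becomes a combination of standard monomials after multiplication by a power of
the initial maximal minor. -/
theorem exists_pow_mul_mem_standardSubalgebra [Infinite K] (hm : n ≤ m) (hq : n ≤ q)
    {f : KX K n m q} (hf : IsGLInvariant f) :
    ∃ N : ℕ, pPoly K n m q (PairIx.initial hm hq) ^ N * f ∈ standardSubalgebra K n m q := by
  set d := pPoly K n m q (PairIx.initial hm hq) with hd
  let Z : Matrix (Fin m) (Fin q) (KX K n m q) := Matrix.of (phi K n m q)
  let Z₁ := Z.submatrix (Fin.castLE hm) (Fin.castLE hq)
  let P : (Fin m × Fin n) ⊕ (Fin n × Fin q) → KX K n m q :=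
    Sum.elim (fun p => d * Z p.1 (Fin.castLE hq p.2))
      (fun p => (Z₁.adjugate * Z.submatrix (Fin.castLE hm) id) p.1 p.2)
  have hZ : ∀ i j, Z i j ∈ standardSubalgebra K n m q := phi_mem_standardSubalgebra K
  have hdmem : d ∈ standardSubalgebra K n m q := pPoly_mem_standardSubalgebra K _
  have hP : ∀ v, P v ∈ standardSubalgebra K n m q := by
    rintro (⟨i, j⟩ | ⟨k, l⟩)
    · exact mul_mem hdmem (hZ _ _)
    · simp only [P, Sum.elim_inr, Matrix.mul_apply]
      exact sum_mem fun i _ =>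
        mul_mem (adjugate_mem_of_forall_mem (fun i j => hZ _ _) _ _) (hZ _ _)
  obtain ⟨N, G, hG, h⟩ := exists_clear_denominators (standardSubalgebra K n m q) hdmem hP f
  refine ⟨N, ?_⟩
  suffices heq : d ^ N * f = G by rwa [heq]
  have hd0 : d ≠ 0 := pPoly_ne_zero K _ le_rfl
  refine mul_left_cancel₀ hd0 (MvPolynomial.funext fun pt => ?_)
  rw [map_mul, map_mul, map_mul]
  by_cases hpt : MvPolynomial.eval pt d = 0
  · rw [hpt, zero_mul, zero_mul]
  rw [h pt hpt, map_pow]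
  congr 2
  let U : Matrix (Fin m) (Fin n) K := Matrix.of fun i j => pt (Sum.inl (i, j))
  let W : Matrix (Fin n) (Fin q) K := Matrix.of fun k l => pt (Sum.inr (k, l))
  have hUW : pt = Sum.elim (fun p => U p.1 p.2) (fun p => W p.1 p.2) := by
    funext v
    rcases v with v | v <;> rfl
  have heval : ∀ g : KX K n m q, MvPolynomial.eval pt g = evalX K n m q U W g := by
    intro g
    rw [evalX, ← hUW]
  let Y₁ := (U * W).submatrix (Fin.castLE hm) (Fin.castLE hq)
  have hY₁ : Y₁ = U.submatrix (Fin.castLE hm) id * W.submatrix id (Fin.castLE hq) := rfl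
  have hdY : MvPolynomial.eval pt d = Y₁.det := by rw [heval, hd, evalX_pPoly]; rfl
  have hW : (W.submatrix id (Fin.castLE hq)).det ≠ 0 := by
    rw [hdY, hY₁, Matrix.det_mul] at hpt
    exact right_ne_zero_of_mul hpt
  let A : GL (Fin n) K := Matrix.GeneralLinearGroup.mkOfDetNeZero _ hW
  have hA : (A : Matrix (Fin n) (Fin n) K) = W.submatrix id (Fin.castLE hq) := rfl
  have hinv := hf A U W
  rw [evalX, evalX, ← hUW] at hinv
  rw [← hinv]
  congr 2
  funext v
  rcases v with ⟨i, j⟩ | ⟨k, l⟩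
  · simp only [P, Sum.elim_inl, map_mul]
    rw [mul_div_cancel_left₀ _ hpt, heval]
    exact (evalX_phi U W _ _).symm
  · have hmap : MvPolynomial.eval pt (P (Sum.inr (k, l))) =
        (Y₁.adjugate * (U * W).submatrix (Fin.castLE hm) id) k l := by
      have h1 : (MvPolynomial.eval pt).mapMatrix Z₁ = Y₁ := by
        ext i j
        exact (heval _).trans (evalX_phi U W _ _)
      rw [← h1, ← RingHom.map_adjugate]
      simp only [P, Sum.elim_inr, Matrix.mul_apply, map_sum, map_mul]
      refine Finset.sum_congr rfl fun i _ => ?_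
      congr 1
      exact ((heval _).trans (evalX_phi U W _ _)).trans (Matrix.mul_apply ..)
    have hmul : (U * W).submatrix (Fin.castLE hm) id =
        Y₁ * (((A⁻¹ : GL (Fin n) K) : Matrix (Fin n) (Fin n) K) * W) := by
      rw [hY₁, ← hA, Matrix.mul_assoc, ← Matrix.mul_assoc (A : Matrix (Fin n) (Fin n) K), ← Units.val_mul,
        mul_inv_cancel, Units.val_one, Matrix.one_mul]
      rfl
    rw [hmap, hmul, ← Matrix.mul_assoc, Matrix.adjugate_mul, Matrix.smul_mul, Matrix.one_mul,
      Matrix.smul_apply, ← hdY, smul_eq_mul, mul_div_cancel_left₀ _ hpt]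
    rfl

theorem mem_standardSpan_of_isGLInvariant [Infinite K] (hn : 0 < n) (hm : n ≤ m) (hq : n ≤ q)
    {f : KX K n m q} (hf : IsGLInvariant f) : f ∈ standardSpan K n m q := by
  obtain ⟨N, hN⟩ := exists_pow_mul_mem_standardSubalgebra hm hq hf
  set d := pPoly K n m q (PairIx.initial hm hq) with hd
  change d ^ N * f ∈ standardSpan K n m q at hN
  induction N with
  | zero => rwa [pow_zero, one_mul] at hN
  | succ N ih =>
    refine ih ?_
    let v : {L : List {x : PairIx m q // 0 < x.s ∧ x.s ≤ n} //
        L.Pairwise fun a b => a.val.ge b.val} → KX K n m q :=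
      fun L => (L.val.map fun x => pPoly K n m q x.val).prod
    have hv : standardSpan K n m q = Submodule.span K (Set.range v) := by
      rw [standardSpan]
      congr 1
      ext z
      simp only [Set.mem_ofPred_eq, Set.mem_range, Subtype.exists, v]
      exact exists_congr fun L => by rw [exists_prop, eq_comm]
    rw [hv] at hN ⊢
    rw [pow_succ', mul_assoc] at hN
    have hdeg : ∀ L, (columnOrder n m q).degree (v L) = listLead L.val :=
      fun L => degree_prod_pPoly K L.val
    refine mem_span_of_mul_mem_span (v := v) (d := d) (columnOrder n m q)
      (fun L => prod_pPoly_ne_zero K L.val) (fun L L' h => Subtype.ext ?_)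
      (pPoly_ne_zero K _ le_rfl) (fun L hL => ?_) hN
    · exact eq_of_listLead_eq L.2 L'.2 (by simpa only [hdeg] using h)
    · rw [hdeg, hd, degree_pPoly (n := n) K (PairIx.initial hm hq) le_rfl] at hL
      obtain ⟨L', hL'⟩ := exists_append_initial hn hm hq L.2 hL
      refine ⟨⟨L', (List.pairwise_append.mp (hL' ▸ L.2)).1⟩, ?_⟩
      simp only [v]
      rw [hL', List.map_append, List.prod_append, mul_comm]
      simp [hd]

end Spanning

end SMB

open SMB in
/-- **Standard monomial basis for `K[X]^{GL_n(K)}`.**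
The standard monomials in the minors `p(A,B)` with `1 ≤ |A| = |B| ≤ n` (products over weakly
decreasing chains in the poset of index pairs, the empty product being `1`) are linearly
independent over `K` and span the ring of invariants `K[X]^{GL_n(K)}` as a `K`-vector space;
that is, they form a `K`-basis of `K[X]^{GL_n(K)}`. -/
theorem gl_standard_monomial_basis (K : Type) [Field K] [IsAlgClosed K]
    (n m q : ℕ) (hn : 0 < n) (hm : n < m) (hq : n < q) :
    LinearIndependent K
      (fun L : {L : List {x : PairIx m q // 0 < x.s ∧ x.s ≤ n} //
          L.Chain' fun a b => PairIx.ge a.val b.val} =>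
        (L.val.map fun x => pPoly K n m q x.val).prod) ∧
    Submodule.span K
      (Set.range (fun L : {L : List {x : PairIx m q // 0 < x.s ∧ x.s ≤ n} //
          L.Chain' fun a b => PairIx.ge a.val b.val} =>
        (L.val.map fun x => pPoly K n m q x.val).prod)) =
      Subalgebra.toSubmodule (glInvariants K n m q) := by
  have hpair : ∀ L : List {x : PairIx m q // 0 < x.s ∧ x.s ≤ n},
      L.IsChain (fun a b => PairIx.ge a.val b.val) ↔
        L.Pairwise fun a b => PairIx.ge a.val b.val := fun L =>
    haveI : IsTrans {x : PairIx m q // 0 < x.s ∧ x.s ≤ n} fun a b => PairIx.ge a.val b.val :=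
      ⟨fun _ _ _ h h' => PairIx.ge_trans h h'⟩
    List.isChain_iff_pairwise
  refine ⟨linearIndependent_of_degree_injective (columnOrder n m q)
    (fun L => prod_pPoly_ne_zero K L.val) fun L L' h => Subtype.ext ?_, le_antisymm ?_ ?_⟩
  · simp only [degree_prod_pPoly] at h
    exact eq_of_listLead_eq ((hpair _).mp L.2) ((hpair _).mp L'.2) h
  · refine Submodule.span_le.mpr ?_
    rintro _ ⟨L, rfl⟩
    refine (glInvariants K n m q).list_prod_mem fun z hz => ?_
    obtain ⟨x, _, rfl⟩ := List.mem_map.mp hz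
    exact pPoly_mem_glInvariants x.val
  · intro f hf
    refine Submodule.span_mono ?_ (mem_standardSpan_of_isGLInvariant hn hm.le hq.le hf)
    rintro _ ⟨L, hL, rfl⟩
    exact ⟨⟨L, (hpair L).mpr hL⟩, rfl⟩
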